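/- Within the space 𝒬 of real symmetric traceless 3×3 matrices, the topological interior of 𝒬_phy equals {Q ∈ 𝒬 : every eigenvalue of Q lies in the open interval (−1/3, 2/3)}, and the topological boundary (frontier) of 𝒬_phy equals {Q ∈ 𝒬 : every eigenvalue of Q lies in [−1/3, 2/3] and the smallest eigenvalue of Q equals −1/3}. -/

import Mathlib

/-- `𝒬`: the space of real symmetric traceless 3×3 matrices, with its subspace topology
(induced by the Frobenius norm, equivalently the product topology). -/
def QSpace : Type := {Q : Matrix (Fin 3) (Fin 3) ℝ // Q.IsSymm ∧ Q.trace = 0}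

instance : TopologicalSpace QSpace :=
  inferInstanceAs (TopologicalSpace {Q : Matrix (Fin 3) (Fin 3) ℝ // Q.IsSymm ∧ Q.trace = 0})

/-- `𝒬_phy` as a subset of `𝒬`: all eigenvalues lie in `[-1/3, 2/3]`. -/
def QPhy : Set QSpace :=
  {Q | spectrum ℝ (Q.1 : Matrix (Fin 3) (Fin 3) ℝ) ⊆ Set.Icc (-(1:ℝ)/3) (2/3)}

namespace QSpace

open Matrix Topology

lemma isHermitian (Q : QSpace) : Q.1.IsHermitian := by
  have h := Q.2.1
  rwa [Matrix.IsHermitian, Matrix.conjTranspose_eq_transpose_of_trivial]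

lemma sum_eigenvalues (Q : QSpace) :
    Q.isHermitian.eigenvalues 0 + Q.isHermitian.eigenvalues 1 + Q.isHermitian.eigenvalues 2 = 0 := by
  have h := Q.isHermitian.trace_eq_sum_eigenvalues
  rw [Q.2.2, Fin.sum_univ_three] at h
  simpa using h.symm

lemma spectrum_subset_iff (Q : QSpace) (s : Set ℝ) :
    spectrum ℝ Q.1 ⊆ s ↔ ∀ i, Q.isHermitian.eigenvalues i ∈ s := by
  rw [Q.isHermitian.spectrum_real_eq_range_eigenvalues, Set.range_subset_iff]

/-- By tracelessness, the lower bound on the eigenvalues implies the upper one. -/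
lemma mem_QPhy_iff (Q : QSpace) : Q ∈ QPhy ↔ spectrum ℝ Q.1 ⊆ Set.Ici (-(1 : ℝ) / 3) := by
  have h := Q.sum_eigenvalues
  rw [QPhy, Set.mem_ofPred_eq, spectrum_subset_iff, spectrum_subset_iff]
  simp [Fin.forall_fin_succ] at *
  grind

lemma spectrum_subset_Ioo_iff (Q : QSpace) :
    spectrum ℝ Q.1 ⊆ Set.Ioo (-(1 : ℝ) / 3) (2 / 3) ↔
      Q ∈ QPhy ∧ -(1 : ℝ) / 3 ∉ spectrum ℝ Q.1 := by
  have h := Q.sum_eigenvalues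
  rw [mem_QPhy_iff, spectrum_subset_iff, spectrum_subset_iff,
    Q.isHermitian.spectrum_real_eq_range_eigenvalues]
  simp [Fin.forall_fin_succ] at *
  grind

lemma mem_QPhy_iff_posSemidef (Q : QSpace) :
    Q ∈ QPhy ↔ ((1 / 3 : ℝ) • (1 : Matrix (Fin 3) (Fin 3) ℝ) + Q.1).PosSemidef := by
  rw [mem_QPhy_iff, Matrix.posSemidef_iff_isHermitian_and_spectrum_nonneg,
    ← Algebra.algebraMap_eq_smul_one, ← spectrum.singleton_add_eq]
  have hH : (algebraMap ℝ (Matrix (Fin 3) (Fin 3) ℝ) (1 / 3) + Q.1).IsHermitian := by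
    refine Matrix.IsHermitian.add ?_ Q.isHermitian
    rw [Algebra.algebraMap_eq_smul_one, Matrix.IsHermitian]
    simp
  simp only [hH, true_and, Set.singleton_add, Set.image_subset_iff]
  refine forall₂_congr fun x _ ↦ ?_
  simp only [Set.mem_Ici, Set.mem_preimage, Set.mem_ofPred_eq]
  constructor <;> intro <;> linarith

lemma continuous_val : Continuous (fun Q : QSpace ↦ Q.1) :=
  continuous_subtype_val (p := fun Q : Matrix (Fin 3) (Fin 3) ℝ ↦ Q.IsSymm ∧ Q.trace = 0)

lemma isClosed_QPhy : IsClosed QPhy := by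
  have h : QPhy = ⋂ x : Fin 3 → ℝ, {Q : QSpace |
      0 ≤ star x ⬝ᵥ (((1 / 3 : ℝ) • (1 : Matrix (Fin 3) (Fin 3) ℝ) + Q.1) *ᵥ x)} := by
    ext Q
    rw [mem_QPhy_iff_posSemidef, Matrix.posSemidef_iff_dotProduct_mulVec, Set.mem_iInter]
    refine and_iff_right (Matrix.IsHermitian.add ?_ Q.isHermitian)
    rw [Matrix.IsHermitian]
    simp
  rw [h]
  refine isClosed_iInter fun x ↦ isClosed_le continuous_const ?_
  exact continuous_const.dotProduct ((continuous_const.add continuous_val).matrix_mulVec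
    continuous_const)

open scoped Matrix.Norms.Operator in
lemma isOpen_setOf_spectrum_subset {s : Set ℝ} (hs : IsOpen s) :
    IsOpen {Q : QSpace | spectrum ℝ Q.1 ⊆ s} := by
  have h := upperHemicontinuous_spectrum ℝ (Matrix (Fin 3) (Fin 3) ℝ)
  rw [upperHemicontinuous_iff_isOpen_preimage_Iic] at h
  exact (h s hs).preimage continuous_val

lemma notMem_spectrum_of_mem_interior {Q : QSpace} (hQ : Q ∈ interior QPhy) :
    -(1 : ℝ) / 3 ∉ spectrum ℝ Q.1 := by
  intro hmem
  let f : ℝ → QSpace := fun t ↦ ⟨t • Q.1, Q.2.1.smul t, by rw [Matrix.trace_smul, Q.2.2, smul_zero]⟩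
  have hf : Continuous f := (continuous_id.smul continuous_const).subtype_mk _
  have hf1 : f 1 = Q := Subtype.ext (one_smul ℝ Q.1)
  have hev : ∀ᶠ t in 𝓝[>] (1 : ℝ), f t ∈ QPhy :=
    nhdsWithin_le_nhds <| hf.continuousAt.eventually <| by
      rw [hf1]
      exact mem_interior_iff_mem_nhds.mp hQ
  obtain ⟨t, htQ, ht⟩ := (hev.and self_mem_nhdsWithin).exists
  have ht : 1 < t := ht
  have hmem' : t * (-(1 : ℝ) / 3) ∈ spectrum ℝ (t • Q.1) :=
    (spectrum.smul_mem_smul_iff (r := Units.mk0 t (by positivity))).mpr hmem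
  have := (htQ hmem').1
  linarith

lemma interior_QPhy :
    interior QPhy = {Q : QSpace | spectrum ℝ Q.1 ⊆ Set.Ioo (-(1 : ℝ) / 3) (2 / 3)} := by
  refine Set.Subset.antisymm (fun Q hQ ↦ ?_) (interior_maximal ?_ ?_)
  · exact Q.spectrum_subset_Ioo_iff.mpr
      ⟨interior_subset hQ, notMem_spectrum_of_mem_interior hQ⟩
  · exact fun Q hQ ↦ (Q.spectrum_subset_Ioo_iff.mp hQ).1
  · exact isOpen_setOf_spectrum_subset isOpen_Ioo

end QSpace

/-- Within `𝒬`, the interior of `𝒬_phy` consists of those matrices whose eigenvalues all lie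
in `(-1/3, 2/3)`, and the frontier of `𝒬_phy` consists of those matrices whose eigenvalues all
lie in `[-1/3, 2/3]` with smallest eigenvalue equal to `-1/3` (i.e. `-1/3` is an eigenvalue). -/
theorem stmt11 :
    interior QPhy =
      {Q : QSpace | spectrum ℝ (Q.1 : Matrix (Fin 3) (Fin 3) ℝ) ⊆ Set.Ioo (-(1:ℝ)/3) (2/3)} ∧
    frontier QPhy =
      {Q : QSpace | spectrum ℝ (Q.1 : Matrix (Fin 3) (Fin 3) ℝ) ⊆ Set.Icc (-(1:ℝ)/3) (2/3) ∧
        (-(1:ℝ)/3) ∈ spectrum ℝ (Q.1 : Matrix (Fin 3) (Fin 3) ℝ)} := by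
  refine ⟨QSpace.interior_QPhy, ?_⟩
  ext Q
  rw [QSpace.isClosed_QPhy.frontier_eq, QSpace.interior_QPhy, Set.mem_sdiff, Set.mem_ofPred_eq,
    Q.spectrum_subset_Ioo_iff, not_and_not_right]
  exact and_congr_right fun h ↦ ⟨fun h' ↦ h' h, fun h' _ ↦ h'⟩
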